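/- Let F be an IFS with equal ratio r on ℝ^d with attractor A, assume 0 ∈ A, and assume F is of finite type (the set of proper neighbor maps is finite). Then for every D > 0 the set of neighbor maps h of F whose translation part satisfies ‖v(h)‖ ≤ D is finite. -/

import Mathlib

/-- Composition of the maps of an IFS along a word of indices:
`wordComp f [i₁,…,iₙ] = f i₁ ∘ ⋯ ∘ f iₙ`. -/
def wordComp {E : Type*} {m : ℕ} (f : Fin m → E → E) : List (Fin m) → E → E
  | [] => id
  | i :: w => f i ∘ wordComp f w

/-- Neighbor maps of the IFS `F = {f 1, …, f m}`: maps `h = f⁻¹ ∘ g` with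
`f, g ∈ F^n` for some `n ≥ 1`, encoded by the equation `f ∘ h = g`. -/
def neighborMaps {E : Type*} {m : ℕ} (f : Fin m → E → E) : Set (E → E) :=
  {h | ∃ u w : List (Fin m), u ≠ [] ∧ u.length = w.length ∧
      wordComp f u ∘ h = wordComp f w}

open Filter Topology

theorem wordComp_append {E : Type*} {m : ℕ} (f : Fin m → E → E) (u w : List (Fin m)) :
    wordComp f (u ++ w) = wordComp f u ∘ wordComp f w := by
  induction u with
  | nil => rfl
  | cons i u ih => simp [wordComp, ih, Function.comp_assoc]

theorem wordComp_singleton {E : Type*} {m : ℕ} (f : Fin m → E → E) (i : Fin m) :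
    wordComp f [i] = f i := rfl

theorem wordComp_surjective {E : Type*} {m : ℕ} {f : Fin m → E → E}
    (hf : ∀ k, Function.Surjective (f k)) (u : List (Fin m)) :
    Function.Surjective (wordComp f u) := by
  induction u with
  | nil => exact Function.surjective_id
  | cons i u ih => exact (hf i).comp ih

theorem wordComp_injective {E : Type*} {m : ℕ} {f : Fin m → E → E}
    (hf : ∀ k, Function.Injective (f k)) (u : List (Fin m)) :
    Function.Injective (wordComp f u) := by
  induction u with
  | nil => exact Function.injective_id
  | cons i u ih => exact (hf i).comp ih

theorem dist_wordComp {E : Type*} [PseudoMetricSpace E] {m : ℕ} {f : Fin m → E → E} {r : ℝ}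
    (hsim : ∀ k x y, dist (f k x) (f k y) = r * dist x y) (u : List (Fin m)) (x y : E) :
    dist (wordComp f u x) (wordComp f u y) = r ^ u.length * dist x y := by
  induction u with
  | nil => simp [wordComp]
  | cons i u ih => simp [wordComp, hsim, ih, pow_succ', mul_assoc]

theorem isometry_of_mem_neighborMaps {E : Type*} [PseudoMetricSpace E] {m : ℕ}
    {f : Fin m → E → E} {r : ℝ} (hr : 0 < r)
    (hsim : ∀ k x y, dist (f k x) (f k y) = r * dist x y) {h : E → E}
    (hh : h ∈ neighborMaps f) : Isometry h := by
  obtain ⟨u, w, -, hlen, huw⟩ := hh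
  refine Isometry.of_dist_eq fun x y => ?_
  have key := dist_wordComp hsim u (h x) (h y)
  rw [← Function.comp_apply (f := wordComp f u), ← Function.comp_apply (f := wordComp f u), huw,
    dist_wordComp hsim, ← hlen] at key
  exact (mul_left_cancel₀ (pow_pos hr _).ne' key).symm

theorem id_mem_neighborMaps {E : Type*} {m : ℕ} (f : Fin m → E → E) (hm : 0 < m) :
    id ∈ neighborMaps f :=
  ⟨[⟨0, hm⟩], [⟨0, hm⟩], by simp, rfl, rfl⟩

/-- The maps `f i⁻¹ ∘ g ∘ f j` with `g ∈ S`. -/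
def childMaps {E : Type*} {m : ℕ} (f : Fin m → E → E) (S : Set (E → E)) : Set (E → E) :=
  {h | ∃ g ∈ S, ∃ i j, f i ∘ h = g ∘ f j}

theorem Set.Finite.childMaps {E : Type*} {m : ℕ} {f : Fin m → E → E}
    (hf : ∀ k, Function.Injective (f k)) {S : Set (E → E)} (hS : S.Finite) :
    (childMaps f S).Finite := by
  have : _root_.childMaps f S = ⋃ g ∈ S, ⋃ i, ⋃ j, {h | f i ∘ h = g ∘ f j} := by
    ext h; simp [_root_.childMaps]
  rw [this]
  refine hS.biUnion fun g _ => Set.finite_iUnion fun i => Set.finite_iUnion fun j => ?_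
  exact Set.Subsingleton.finite fun a ha b hb => (hf i).comp_left (ha.trans hb.symm)

/-- Every neighbor map arises from the identity by repeatedly passing from a neighbor map `g`
to some `f i⁻¹ ∘ g ∘ f j`. -/
theorem neighborMaps_induction {E : Type*} {m : ℕ} {f : Fin m → E → E} (hm : 0 < m)
    (hinj : ∀ k, Function.Injective (f k)) (hsurj : ∀ k, Function.Surjective (f k))
    {P : (E → E) → Prop} (hid : P id)
    (hstep : ∀ g ∈ neighborMaps f, ∀ h ∈ neighborMaps f, ∀ i j, f i ∘ h = g ∘ f j → P g → P h)
    {h : E → E} (hh : h ∈ neighborMaps f) : P h := by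
  obtain ⟨u, w, -, hlen, huw⟩ := hh
  induction u using List.reverseRecOn generalizing w h with
  | nil =>
    obtain rfl : w = [] := List.length_eq_zero_iff.1 hlen.symm
    rwa [show h = id from huw]
  | append_singleton u i ih =>
    obtain rfl | ⟨w, j, rfl⟩ := w.eq_nil_or_concat'
    · simp at hlen
    have hlen' : u.length = w.length := by simpa using hlen
    obtain ⟨g, hg⟩ := (wordComp_surjective hsurj u).comp_left (wordComp f w)
    have hgN : g ∈ neighborMaps f := by
      by_cases hu : u = []
      · subst hu
        obtain rfl : w = [] := List.length_eq_zero_iff.1 hlen'.symm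
        rw [show g = id from hg]
        exact id_mem_neighborMaps f hm
      · exact ⟨u, w, hu, hlen', hg⟩
    refine hstep g hgN h ⟨_, _, by simp, hlen, huw⟩ i j ?_ (ih w hlen' hg)
    apply (wordComp_injective hinj u).comp_left
    simp only [wordComp_append, wordComp_singleton, ← hg] at huw
    exact huw

theorem IsCompact.exists_pos_le_dist_of_disjoint_image {E : Type*} [PseudoMetricSpace E]
    {A : Set E} (hA : IsCompact A) (hne : A.Nonempty) {h : E → E} (hh : Continuous h)
    (hdisj : ∀ a ∈ A, ∀ b ∈ A, 0 < dist a (h b)) :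
    ∃ δ > 0, ∀ a ∈ A, ∀ b ∈ A, δ ≤ dist a (h b) := by
  obtain ⟨p, hp, hmin⟩ := (hA.prod hA).exists_isMinOn (hne.prod hne)
    (f := fun p => dist p.1 (h p.2)) (by fun_prop)
  exact ⟨_, hdisj p.1 hp.1 p.2 hp.2, fun a ha b hb => hmin (Set.mk_mem_prod ha hb)⟩

theorem surjective_of_dist_eq_mul {E : Type*} [NormedAddCommGroup E] [NormedSpace ℝ E]
    [StrictConvexSpace ℝ E] [FiniteDimensional ℝ E] {f : E → E} {r : ℝ} (hr : 0 < r)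
    (hf : ∀ x y, dist (f x) (f y) = r * dist x y) : Function.Surjective f := by
  have hiso : Isometry fun x => r⁻¹ • f x := Isometry.of_dist_eq fun x y => by
    rw [dist_smul₀, hf, Real.norm_of_nonneg (inv_nonneg.2 hr.le), inv_mul_cancel_left₀ hr.ne']
  intro y
  have : Inhabited E := ⟨0⟩
  obtain ⟨x, hx⟩ := (hiso.affineIsometryOfStrictConvexSpace.toAffineIsometryEquiv rfl).surjective
    (r⁻¹ • y)
  exact ⟨x, smul_right_injective E (inv_ne_zero hr.ne') hx⟩

/-- If there are only finitely many proper neighbor maps, then a neighbor map `h` bringing `h '' A`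
close enough to `A` is proper. -/
theorem exists_pos_forall_proper_of_dist_lt {E : Type*} [MetricSpace E] {m : ℕ}
    {f : Fin m → E → E} {r : ℝ} (hr0 : 0 < r) (hr1 : r < 1) (hm : 0 < m)
    (hsim : ∀ k x y, dist (f k x) (f k y) = r * dist x y)
    (hinj : ∀ k, Function.Injective (f k)) (hsurj : ∀ k, Function.Surjective (f k))
    {A : Set E} (hAne : A.Nonempty) (hAcp : IsCompact A) (hmaps : ∀ k, ∀ a ∈ A, f k a ∈ A)
    (hFT : {h | h ∈ neighborMaps f ∧ (A ∩ h '' A).Nonempty}.Finite) :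
    ∃ δ > 0, ∀ h ∈ neighborMaps f, ∀ a ∈ A, ∀ b ∈ A, dist a (h b) < δ →
      (A ∩ h '' A).Nonempty := by
  have hev : ∀ᶠ δ in 𝓝[>] (0 : ℝ), ∀ h ∈ childMaps f
      {h | h ∈ neighborMaps f ∧ (A ∩ h '' A).Nonempty}, h ∈ neighborMaps f →
      ∀ a ∈ A, ∀ b ∈ A, dist a (h b) < δ → (A ∩ h '' A).Nonempty := by
    refine (eventually_all_finite (hFT.childMaps hinj)).2 fun h _ => ?_
    by_cases hp : (A ∩ h '' A).Nonempty
    · exact Eventually.of_forall fun _ _ _ _ _ _ _ => hp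
    by_cases hh : h ∈ neighborMaps f
    · obtain ⟨δ, hδ, hle⟩ := hAcp.exists_pos_le_dist_of_disjoint_image hAne
        (isometry_of_mem_neighborMaps hr0 hsim hh).continuous fun a ha b hb =>
          dist_pos.2 fun hab => hp ⟨a, ha, b, hb, hab.symm⟩
      filter_upwards [Ioo_mem_nhdsGT hδ] with ε hε _ a ha b hb hlt
      exact absurd hlt (not_lt.2 (hε.2.le.trans (hle a ha b hb)))
    · exact Eventually.of_forall fun _ hh' => absurd hh' hh
  obtain ⟨δ, hδ, hδ0⟩ := (hev.and self_mem_nhdsWithin).exists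
  refine ⟨δ, hδ0, fun h hh => ?_⟩
  refine neighborMaps_induction hm hinj hsurj (P := fun h => ∀ a ∈ A, ∀ b ∈ A,
    dist a (h b) < δ → (A ∩ h '' A).Nonempty) ?_ ?_ hh
  · obtain ⟨a, ha⟩ := hAne
    exact fun _ _ _ _ _ => ⟨a, ha, a, ha, rfl⟩
  · intro g hg h hh i j hgh ih a ha b hb hlt
    refine hδ h ⟨g, ⟨hg, ih _ (hmaps i a ha) _ (hmaps j b hb) ?_⟩, i, j, hgh⟩ hh a ha b hb hlt
    rw [← Function.comp_apply (f := g), ← hgh, Function.comp_apply, hsim]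
    exact (mul_le_of_le_one_left dist_nonneg hr1.le).trans_lt hlt

theorem finite_neighborMaps_pow_mul_dist_lt {E : Type*} [MetricSpace E] {m : ℕ}
    {f : Fin m → E → E} {r : ℝ} (hm : 0 < m)
    (hsim : ∀ k x y, dist (f k x) (f k y) = r * dist x y)
    (hinj : ∀ k, Function.Injective (f k)) (hsurj : ∀ k, Function.Surjective (f k))
    {A : Set E} (hmaps : ∀ k, ∀ a ∈ A, f k a ∈ A)
    (hFT : {h | h ∈ neighborMaps f ∧ (A ∩ h '' A).Nonempty}.Finite) {δ : ℝ}
    (hδ : ∀ h ∈ neighborMaps f, ∀ a ∈ A, ∀ b ∈ A, dist a (h b) < δ → (A ∩ h '' A).Nonempty)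
    (k : ℕ) :
    {h | h ∈ neighborMaps f ∧ ∃ a ∈ A, ∃ b ∈ A, r ^ k * dist a (h b) < δ}.Finite := by
  induction k with
  | zero =>
    refine hFT.subset ?_
    rintro h ⟨hh, a, ha, b, hb, hlt⟩
    exact ⟨hh, hδ h hh a ha b hb (by simpa using hlt)⟩
  | succ k ih =>
    refine ((ih.childMaps hinj).insert id).subset ?_
    rintro h ⟨hh, a, ha, b, hb, hlt⟩
    revert hlt
    refine neighborMaps_induction hm hinj hsurj (P := fun h => r ^ (k + 1) * dist a (h b) < δ →
      h ∈ insert id (childMaps f _)) (fun _ => Set.mem_insert _ _) ?_ hh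
    · intro g hg h _ i j hgh _ hlt
      refine Or.inr ⟨g, ⟨hg, _, hmaps i a ha, _, hmaps j b hb, ?_⟩, i, j, hgh⟩
      rwa [← Function.comp_apply (f := g), ← hgh, Function.comp_apply, hsim, ← mul_assoc,
        ← pow_succ]

/-- **Finite type bounds the number of neighbor maps with bounded translation part.**
Let `F` be an IFS with equal ratio `r` on `ℝ^d`, with attractor `A ∋ 0`, and assume
`F` is of finite type (finitely many proper neighbor maps). Then for every `D > 0`
the set of neighbor maps `h` whose translation part `v(h) = h 0` satisfies
`‖h 0‖ ≤ D` is finite. (Every neighbor map is an isometry `h x = s x + v`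
with `s` linear, so its translation part is `v = h 0`.) -/
theorem finite_neighbors_of_bounded_translation
    (d : ℕ) (r : ℝ) (hr0 : 0 < r) (hr1 : r < 1)
    (m : ℕ) (hm : 0 < m)
    (f : Fin m → EuclideanSpace ℝ (Fin d) → EuclideanSpace ℝ (Fin d))
    (hsim : ∀ k x y, dist (f k x) (f k y) = r * dist x y)
    (A : Set (EuclideanSpace ℝ (Fin d))) (hAne : A.Nonempty) (hAcp : IsCompact A)
    (hA : A = ⋃ k, f k '' A) (h0A : (0 : EuclideanSpace ℝ (Fin d)) ∈ A)
    (hFT : {h | h ∈ neighborMaps f ∧ (A ∩ h '' A).Nonempty}.Finite) :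
    ∀ D : ℝ, 0 < D → {h | h ∈ neighborMaps f ∧ ‖h 0‖ ≤ D}.Finite := by
  intro D _
  have hinj : ∀ k, Function.Injective (f k) := fun k x y hxy => by
    have := hsim k x y
    rw [hxy, dist_self, zero_eq_mul] at this
    exact dist_eq_zero.1 (this.resolve_left hr0.ne')
  have hsurj : ∀ k, Function.Surjective (f k) := fun k => surjective_of_dist_eq_mul hr0 (hsim k)
  have hmaps : ∀ k, ∀ a ∈ A, f k a ∈ A := fun k a ha => by
    rw [hA]
    exact Set.mem_iUnion.2 ⟨k, a, ha, rfl⟩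
  obtain ⟨δ, hδ0, hδ⟩ :=
    exists_pos_forall_proper_of_dist_lt hr0 hr1 hm hsim hinj hsurj hAne hAcp hmaps hFT
  obtain ⟨k, hk⟩ := (((tendsto_pow_atTop_nhds_zero_of_lt_one hr0.le hr1).mul_const D).eventually
    (gt_mem_nhds (by simpa using hδ0))).exists
  refine (finite_neighborMaps_pow_mul_dist_lt hm hsim hinj hsurj hmaps hFT hδ k).subset ?_
  rintro h ⟨hh, hD⟩
  refine ⟨hh, 0, h0A, 0, h0A, lt_of_le_of_lt ?_ hk⟩
  rw [dist_zero_left]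
  gcongr
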